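/- arXiv:1504.07424 — 2 statements merged into one kernel-verified Lean document; each statement's English description precedes it below -/
import Mathlib

section
/- Let S be a numerical semigroup. The function n ↦ Δ(n) assigning to each element of S its Delta set is eventually periodic: there exist positive integers N₀ and P such that Δ(n + P) = Δ(n) for every n ∈ S with n ≥ N₀. -/
/-- The set of factorizations `Z(n)` of `n ∈ ℕ` with respect to the generators
`m_1, …, m_e` of a numerical semigroup. -/
def factsOf {e : ℕ} (m : Fin e → ℕ) (n : ℕ) : Set (Fin e → ℕ) :=
  {x | ∑ i, x i * m i = n}

/-- The length `|x| = x₁ + ⋯ + x_e` of a factorization. -/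
def len {e : ℕ} (x : Fin e → ℕ) : ℕ := ∑ i, x i

/-- The set of lengths `L(n)`. -/
def lengthsOf {e : ℕ} (m : Fin e → ℕ) (n : ℕ) : Set ℕ :=
  len '' factsOf m n

/-- The Delta set `Δ(n)`: the set of gaps between consecutive lengths of
factorizations of `n`. -/
def deltaOf {e : ℕ} (m : Fin e → ℕ) (n : ℕ) : Set ℕ :=
  {d | 0 < d ∧ ∃ l, l ∈ lengthsOf m n ∧ l + d ∈ lengthsOf m n ∧
    ∀ l', l < l' → l' < l + d → l' ∉ lengthsOf m n}

/-- The homomorphism sending `x` to the pair consisting of the element it factors and its length. -/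
def valueLen {e : ℕ} (m : Fin e → ℕ) : (Fin e → ℕ) →+ ℕ × ℕ where
  toFun x := (∑ i, x i * m i, len x)
  map_zero' := by simp [len]
  map_add' x y := by simp [len, add_mul, Finset.sum_add_distrib]

theorem mem_lengthsOf_iff {e : ℕ} {m : Fin e → ℕ} {n l : ℕ} :
    l ∈ lengthsOf m n ↔ ∃ x, valueLen m x = (n, l) :=
  exists_congr fun _ => Prod.mk_inj.symm

theorem valueLen_single {e : ℕ} (m : Fin e → ℕ) (i : Fin e) (a : ℕ) :
    valueLen m (Pi.single i a) = (a * m i, a) := by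
  simp [valueLen, len, Pi.single_apply]

theorem isSemilinearSet_shifted_lengthsOf {e : ℕ} (m : Fin e → ℕ) (j : ℕ) :
    IsSemilinearSet {p : ℕ × ℕ | p.2 + j ∈ lengthsOf m p.1} := by
  have h := (isSemilinearSet_setOfPred_eq ((0, j) : ℕ × ℕ) 0
    (AddMonoidHom.fst (ℕ × ℕ) (Fin e → ℕ))
    ((valueLen m).comp (AddMonoidHom.snd (ℕ × ℕ) (Fin e → ℕ)))).image
      (AddMonoidHom.fst (ℕ × ℕ) (Fin e → ℕ))
  convert! h using 1
  ext ⟨n, l⟩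
  simp [mem_lengthsOf_iff, eq_comm, add_comm]

theorem isSemilinearSet_mem_deltaOf {e : ℕ} (m : Fin e → ℕ) (d : ℕ) :
    IsSemilinearSet {n | d ∈ deltaOf m n} := by
  rcases Nat.eq_zero_or_pos d with rfl | hd
  · simp [deltaOf]
  have hgap : IsSemilinearSet (⋂ j ∈ Finset.Ioo 0 d, {p : ℕ × ℕ | p.2 + j ∈ lengthsOf m p.1}ᶜ) :=
    .biInter_finset fun j _ => (isSemilinearSet_shifted_lengthsOf m j).compl
  convert! (((isSemilinearSet_shifted_lengthsOf m 0).inter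
    (isSemilinearSet_shifted_lengthsOf m d)).inter hgap).image (AddMonoidHom.fst ℕ ℕ) using 1
  ext n
  simp only [deltaOf, hd, true_and, Set.mem_ofPred_eq, Set.mem_image, Set.mem_inter_iff,
    Set.mem_iInter, Set.mem_compl_iff, Finset.mem_Ioo, AddMonoidHom.coe_fst, Prod.exists,
    exists_and_right, exists_eq_right, add_zero]
  refine exists_congr fun l => and_assoc.symm.trans (and_congr_right fun _ => ?_)
  refine ⟨fun h j hj => h (l + j) (by omega) (by omega), fun h l' h₁ h₂ => ?_⟩
  have := h (l' - l) (by omega)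
  rwa [Nat.add_sub_cancel' h₁.le] at this

theorem le_sum_of_mem_deltaOf {e : ℕ} {m : Fin e → ℕ} (hpos : ∀ i, 0 < m i) {n d : ℕ}
    (hd : d ∈ deltaOf m n) : d ≤ ∑ i, m i := by
  obtain ⟨-, l, hl, hld, hgap⟩ := hd
  obtain ⟨x, hx⟩ := mem_lengthsOf_iff.1 hl
  obtain ⟨y, hy⟩ := mem_lengthsOf_iff.1 hld
  obtain ⟨hxn, hxl⟩ := Prod.mk.inj hx
  obtain ⟨hyn, hyl⟩ := Prod.mk.inj hy
  rcases isEmpty_or_nonempty (Fin e) with _ | _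
  · simp [len] at hxl hyl
    omega
  obtain ⟨k, hk⟩ := Finite.exists_min m
  by_cases hex : ∃ i, m k < m i ∧ m k ≤ x i
  · obtain ⟨i, hki, hxi⟩ := hex
    have hle : Pi.single i (m k) ≤ x := by
      intro j
      rcases eq_or_ne j i with rfl | hji
      · simpa
      · simp [hji]
    obtain ⟨z, rfl⟩ := le_iff_exists_add.1 hle
    have hmem : l + (m i - m k) ∈ lengthsOf m n := by
      refine mem_lengthsOf_iff.2 ⟨Pi.single k (m i) + z, ?_⟩
      rw [map_add, valueLen_single] at hx ⊢
      simp only [Prod.ext_iff, Prod.fst_add, Prod.snd_add] at hx ⊢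
      rw [mul_comm (m i)]
      omega
    have hdi : d ≤ m i - m k := by
      by_contra! h
      exact hgap _ (by omega) (by omega) hmem
    exact hdi.trans ((Nat.sub_le _ _).trans
      (Finset.single_le_sum (f := m) (fun _ _ => Nat.zero_le _) (Finset.mem_univ i)))
  · push Not at hex
    have hlower : m k * (l + d) ≤ n := by
      rw [← hyn, ← hyl, len, Finset.mul_sum]
      exact Finset.sum_le_sum fun i _ => by rw [mul_comm]; exact Nat.mul_le_mul_left _ (hk i)
    have hupper : n ≤ m k * (l + ∑ i, m i) := by
      rw [← hxn, ← hxl, len, ← Finset.sum_add_distrib, Finset.mul_sum]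
      refine Finset.sum_le_sum fun i _ => ?_
      rcases (hk i).eq_or_lt with h | h
      · rw [h]
        nlinarith
      · nlinarith [hex i h]
    have := Nat.le_of_mul_le_mul_left (hlower.trans hupper) (hpos k)
    omega

theorem mem_add_mul_iff {s : Set ℕ} {k p : ℕ} (h : ∀ x ≥ k, x ∈ s ↔ x + p ∈ s) (t : ℕ) :
    ∀ x ≥ k, x ∈ s ↔ x + p * t ∈ s := by
  induction t with
  | zero => simp
  | succ t ih =>
    intro x hx
    rw [ih x hx, h _ (hx.trans (Nat.le_add_right _ _)), mul_add_one, add_assoc]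

theorem exists_common_period {ι : Type*} (F : Finset ι) (s : ι → Set ℕ)
    (hs : ∀ i ∈ F, IsSemilinearSet (s i)) :
    ∃ k, ∃ p > 0, ∀ i ∈ F, ∀ x ≥ k, x ∈ s i ↔ x + p ∈ s i := by
  classical
  simp only [Nat.isSemilinearSet_iff_ultimately_periodic] at hs
  choose! k p hp h using hs
  refine ⟨F.sup k, ∏ i ∈ F, p i, Finset.prod_pos hp, fun i hi x hx => ?_⟩
  rw [← Finset.mul_prod_erase F p hi]
  exact mem_add_mul_iff (h i hi) _ x ((Finset.le_sup hi).trans hx)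

/-- For a numerical semigroup `S`, the function `n ↦ Δ(n)` is eventually periodic:
there are positive integers `N₀` and `P` with `Δ(n + P) = Δ(n)` for all `n ∈ S`
with `n ≥ N₀`. -/
theorem delta_sets_eventually_periodic (e : ℕ) (m : Fin e → ℕ)
    (S : AddSubmonoid ℕ) (hS : ((S : Set ℕ)ᶜ).Finite)
    (hgen : AddSubmonoid.closure (Set.range m) = S)
    (hmono : StrictMono m)
    (hmin : ∀ i, m i ∉ AddSubmonoid.closure (Set.range m \ {m i})) :
    ∃ N₀ P : ℕ, 0 < N₀ ∧ 0 < P ∧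
      ∀ n ∈ S, N₀ ≤ n → deltaOf m (n + P) = deltaOf m n := by
  have hpos : ∀ i, 0 < m i := fun i =>
    Nat.pos_of_ne_zero fun h => hmin i (by rw [h]; exact zero_mem _)
  obtain ⟨k, p, hp, h⟩ := exists_common_period (Finset.range (∑ i, m i + 1))
    (fun d => {n | d ∈ deltaOf m n}) fun d _ => isSemilinearSet_mem_deltaOf m d
  refine ⟨k + 1, p, k.succ_pos, hp, fun n _ hn => Set.ext fun d => ?_⟩
  by_cases hd : d ≤ ∑ i, m i
  · exact (h d (Finset.mem_range_succ_iff.2 hd) n (by omega)).symm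
  · exact iff_of_false (fun h' => hd (le_sum_of_mem_deltaOf hpos h'))
      fun h' => hd (le_sum_of_mem_deltaOf hpos h')
end

section
/- Let S be a numerical semigroup minimally generated by m_1 < m_2 < ⋯ < m_e. Then the catenary degree of S satisfies c(S) = max{ c(m) : m ∈ {m_2, …, m_e} + (Ap(S, m_1) \ {0}) }. -/
/-- The distance between two factorizations:
`d(x,y) = max{|x − x∧y|, |y − x∧y|}` where `x∧y` is the componentwise minimum. -/
def factDist {e : ℕ} (x y : Fin e → ℕ) : ℕ :=
  max (∑ i, (x i - min (x i) (y i))) (∑ i, (y i - min (x i) (y i)))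

/-- The catenary degree `c(n)`: the least `N` such that any two factorizations of
`n` are joined by an `N`-chain (a chain of factorizations of `n` in which
consecutive elements are at distance at most `N`). -/
noncomputable def catDeg {e : ℕ} (m : Fin e → ℕ) (n : ℕ) : ℕ :=
  sInf {N | ∀ x ∈ factsOf m n, ∀ y ∈ factsOf m n,
    Relation.ReflTransGen
      (fun u v => u ∈ factsOf m n ∧ v ∈ factsOf m n ∧ factDist u v ≤ N) x y}

/-- The Apéry set `Ap(S, m) = {s ∈ S : s − m ∉ S}`. -/
def aperySet (S : AddSubmonoid ℕ) (m : ℕ) : Set ℕ :=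
  {s | s ∈ S ∧ ¬ ∃ t ∈ S, s = t + m}

theorem factDist_comm {e : ℕ} (x y : Fin e → ℕ) : factDist x y = factDist y x := by
  simp only [factDist, min_comm, max_comm]

theorem factDist_add_right {e : ℕ} (x y z : Fin e → ℕ) :
    factDist (x + z) (y + z) = factDist x y := by
  simp only [factDist, Pi.add_apply, Nat.add_min_add_right, Nat.add_sub_add_right]

theorem add_mem_factsOf {e : ℕ} {m : Fin e → ℕ} {a b : ℕ} {x y : Fin e → ℕ}
    (hx : x ∈ factsOf m a) (hy : y ∈ factsOf m b) : x + y ∈ factsOf m (a + b) := by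
  simp only [factsOf, Set.mem_ofPred_eq, Pi.add_apply, add_mul, Finset.sum_add_distrib] at *
  rw [hx, hy]

theorem single_mem_factsOf {e : ℕ} (m : Fin e → ℕ) (i : Fin e) :
    Pi.single i 1 ∈ factsOf m (m i) := by
  simp [factsOf, Pi.single_apply]

theorem exists_mem_factsOf {e : ℕ} {m : Fin e → ℕ} {n : ℕ}
    (hn : n ∈ AddSubmonoid.closure (Set.range m)) : ∃ x, x ∈ factsOf m n := by
  induction hn using AddSubmonoid.closure_induction with
  | mem _ h =>
    obtain ⟨i, rfl⟩ := h
    exact ⟨_, single_mem_factsOf m i⟩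
  | zero => exact ⟨0, by simp [factsOf]⟩
  | add _ _ _ _ ha hb =>
    obtain ⟨x, hx⟩ := ha
    obtain ⟨y, hy⟩ := hb
    exact ⟨x + y, add_mem_factsOf hx hy⟩

theorem mem_closure_of_mem_factsOf {e : ℕ} {m : Fin e → ℕ} {n : ℕ} {x : Fin e → ℕ}
    (hx : x ∈ factsOf m n) : n ∈ AddSubmonoid.closure (Set.range m) := by
  rw [← show ∑ i, x i * m i = n from hx]
  refine sum_mem fun i _ => ?_
  rw [← smul_eq_mul]
  exact nsmul_mem (AddSubmonoid.subset_closure (Set.mem_range_self i)) _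

/-- An atom in the support of a factorization can be split off. -/
theorem exists_eq_add_single {e : ℕ} {m : Fin e → ℕ} {n : ℕ} {x : Fin e → ℕ} {i : Fin e}
    (hx : x ∈ factsOf m n) (hi : x i ≠ 0) :
    ∃ k, ∃ y ∈ factsOf m k, n = k + m i ∧ x = y + Pi.single i 1 := by
  have hxy : x = (x - Pi.single i 1) + Pi.single i 1 := by
    refine (tsub_add_cancel_of_le fun j => ?_).symm
    by_cases hj : j = i
    · subst hj
      simpa using Nat.one_le_iff_ne_zero.2 hi
    · simp [hj]
  have hk : x - Pi.single i 1 ∈ factsOf m (∑ j, (x - Pi.single i 1 : Fin e → ℕ) j * m j) := rfl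
  refine ⟨_, _, hk, ?_, hxy⟩
  have h := add_mem_factsOf hk (single_mem_factsOf m i)
  rw [← hxy] at h
  exact (show _ = n from hx).symm.trans h

theorem eq_zero_of_mem_factsOf_zero {e : ℕ} {m : Fin e → ℕ} (hpos : ∀ i, 0 < m i)
    {x : Fin e → ℕ} (hx : x ∈ factsOf m 0) : x = 0 := by
  have h : ∀ i, x i = 0 ∨ m i = 0 := by simpa [factsOf, Finset.sum_eq_zero_iff] using hx
  exact funext fun i => (h i).resolve_right (hpos i).ne'

/-- An atom has only the trivial factorization. -/
theorem eq_single_of_mem_factsOf {e : ℕ} {m : Fin e → ℕ} (hpos : ∀ i, 0 < m i)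
    (hinj : Function.Injective m) {i : Fin e}
    (hmin : m i ∉ AddSubmonoid.closure (Set.range m \ {m i}))
    {x : Fin e → ℕ} (hx : x ∈ factsOf m (m i)) : x = Pi.single i 1 := by
  by_cases hi : x i = 0
  · refine absurd ?_ hmin
    rw [← show ∑ j, x j * m j = m i from hx]
    refine sum_mem fun j _ => ?_
    by_cases hj : j = i
    · simp [hj, hi]
    · rw [← smul_eq_mul]
      have hmem : m j ∈ Set.range m \ {∑ k, x k * m k} :=
        ⟨⟨j, rfl⟩, fun h => hj (hinj (h.trans hx))⟩
      exact nsmul_mem (AddSubmonoid.subset_closure hmem) _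
  · obtain ⟨k, y, hy, hk, rfl⟩ := exists_eq_add_single hx hi
    obtain rfl : k = 0 := by omega
    rw [eq_zero_of_mem_factsOf_zero hpos hy, zero_add]

/-- Two factorizations of `n` are joined by an `N`-chain. -/
def ChainJoined {e : ℕ} (m : Fin e → ℕ) (N n : ℕ) : (Fin e → ℕ) → (Fin e → ℕ) → Prop :=
  Relation.ReflTransGen
    (fun u v => u ∈ factsOf m n ∧ v ∈ factsOf m n ∧ factDist u v ≤ N)

theorem ChainJoined.symm {e : ℕ} {m : Fin e → ℕ} {N n : ℕ} {x y : Fin e → ℕ}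
    (h : ChainJoined m N n x y) : ChainJoined m N n y x := by
  induction h with
  | refl => exact .refl
  | tail _ h ih => exact .head ⟨h.2.1, h.1, (factDist_comm _ _).trans_le h.2.2⟩ ih

theorem ChainJoined.add_right {e : ℕ} {m : Fin e → ℕ} {N a b : ℕ} {x y z : Fin e → ℕ}
    (h : ChainJoined m N a x y) (hz : z ∈ factsOf m b) :
    ChainJoined m N (a + b) (x + z) (y + z) := by
  induction h with
  | refl => exact .refl
  | tail _ h ih =>
    exact .tail ih ⟨add_mem_factsOf h.1 hz, add_mem_factsOf h.2.1 hz,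
      (factDist_add_right _ _ _).trans_le h.2.2⟩

theorem ChainJoined.mono {e : ℕ} {m : Fin e → ℕ} {N M n : ℕ} (hNM : N ≤ M)
    {x y : Fin e → ℕ} (h : ChainJoined m N n x y) : ChainJoined m M n x y := by
  induction h with
  | refl => exact .refl
  | tail _ h ih => exact .tail ih ⟨h.1, h.2.1, h.2.2.trans hNM⟩

theorem factDist_le_of_mem {e : ℕ} {m : Fin e → ℕ} (hpos : ∀ i, 0 < m i) {n : ℕ}
    {x y : Fin e → ℕ} (hx : x ∈ factsOf m n) (hy : y ∈ factsOf m n) : factDist x y ≤ n := by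
  refine max_le ?_ ?_
  · rw [← show ∑ i, x i * m i = n from hx]
    exact Finset.sum_le_sum fun i _ => (Nat.sub_le _ _).trans (Nat.le_mul_of_pos_right _ (hpos i))
  · rw [← show ∑ i, y i * m i = n from hy]
    exact Finset.sum_le_sum fun i _ => (Nat.sub_le _ _).trans (Nat.le_mul_of_pos_right _ (hpos i))

theorem chainJoined_catDeg {e : ℕ} {m : Fin e → ℕ} (hpos : ∀ i, 0 < m i) {n : ℕ}
    {x y : Fin e → ℕ} (hx : x ∈ factsOf m n) (hy : y ∈ factsOf m n) :
    ChainJoined m (catDeg m n) n x y :=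
  Nat.sInf_mem (s := {N | ∀ x ∈ factsOf m n, ∀ y ∈ factsOf m n, ChainJoined m N n x y})
    ⟨n, fun _ hx _ hy => .single ⟨hx, hy, factDist_le_of_mem hpos hx hy⟩⟩ x hx y hy

/-- If `N` bounds the catenary degrees of all elements `m i + w` with `m i` an atom other than
`m i₀` and `w` a nonzero element of the Apéry set of `m i₀`, then any two factorizations
of any element are joined by an `N`-chain. -/
theorem chainJoined_of_forall_aperySet {e : ℕ} {m : Fin e → ℕ} (i₀ : Fin e)
    (hinj : Function.Injective m)
    (hmin : ∀ i, m i ∉ AddSubmonoid.closure (Set.range m \ {m i})) {N : ℕ}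
    (hN : ∀ i ≠ i₀, ∀ w ∈ aperySet (AddSubmonoid.closure (Set.range m)) (m i₀), w ≠ 0 →
      catDeg m (m i + w) ≤ N)
    {n : ℕ} {x y : Fin e → ℕ} (hx : x ∈ factsOf m n) (hy : y ∈ factsOf m n) :
    ChainJoined m N n x y := by
  have hpos : ∀ i, 0 < m i := fun i =>
    Nat.pos_of_ne_zero fun h => hmin i (h ▸ zero_mem _)
  induction n using Nat.strong_induction_on generalizing x y with
  | _ n ih =>
    have share : ∀ i, ∀ u ∈ factsOf m n, ∀ v ∈ factsOf m n, u i ≠ 0 → v i ≠ 0 →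
        ChainJoined m N n u v := by
      intro i u hu v hv hui hvi
      obtain ⟨k, u', hu', rfl, rfl⟩ := exists_eq_add_single hu hui
      obtain ⟨l, v', hv', hl, rfl⟩ := exists_eq_add_single hv hvi
      obtain rfl : k = l := Nat.add_right_cancel hl
      exact (ih k (Nat.lt_add_of_pos_right (hpos i)) hu' hv').add_right (single_mem_factsOf m i)
    by_cases hxy : x = y
    · exact hxy ▸ .refl
    by_cases hA : ∃ i ≠ i₀, ∃ w ∈ aperySet (AddSubmonoid.closure (Set.range m)) (m i₀),
        w ≠ 0 ∧ n = m i + w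
    · obtain ⟨i, hi, w, hw, hw0, rfl⟩ := hA
      exact (chainJoined_catDeg hpos hx hy).mono (hN i hi w hw hw0)
    have hn : n ≠ 0 := by
      rintro rfl
      exact hxy ((eq_zero_of_mem_factsOf_zero hpos hx).trans
        (eq_zero_of_mem_factsOf_zero hpos hy).symm)
    have reach : ∀ u ∈ factsOf m n, ∃ v ∈ factsOf m n, v i₀ ≠ 0 ∧ ChainJoined m N n u v := by
      intro u hu
      by_cases hu0 : u i₀ = 0
      · obtain ⟨i, hi⟩ : ∃ i, u i ≠ 0 := by
          by_contra! h
          exact hn (by simpa [factsOf, h, eq_comm] using hu)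
        have hi0 : i ≠ i₀ := fun h => hi (h ▸ hu0)
        obtain ⟨w, t, ht, hw, -⟩ := exists_eq_add_single hu hi
        have hw0 : w ≠ 0 := by
          rintro rfl
          rw [zero_add] at hw
          subst hw
          exact hxy ((eq_single_of_mem_factsOf hpos hinj (hmin i) hx).trans
            (eq_single_of_mem_factsOf hpos hinj (hmin i) hy).symm)
        have hwA : w ∉ aperySet (AddSubmonoid.closure (Set.range m)) (m i₀) := fun h =>
          hA ⟨i, hi0, w, h, hw0, hw.trans (add_comm _ _)⟩
        obtain ⟨s, hs, rfl⟩ : ∃ s ∈ AddSubmonoid.closure (Set.range m), w = s + m i₀ := by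
          by_contra h
          exact hwA ⟨mem_closure_of_mem_factsOf ht, h⟩
        obtain ⟨z, hz⟩ := exists_mem_factsOf hs
        have hv : z + Pi.single i₀ 1 + Pi.single i 1 ∈ factsOf m n := hw ▸
          add_mem_factsOf (add_mem_factsOf hz (single_mem_factsOf m i₀)) (single_mem_factsOf m i)
        exact ⟨_, hv, by simp, share i u hu _ hv hi (by simp)⟩
      · exact ⟨u, hu, hu0, .refl⟩
    obtain ⟨u, hu, hu0, hxu⟩ := reach x hx
    obtain ⟨v, hv, hv0, hyv⟩ := reach y hy
    exact (hxu.trans (share i₀ u hu v hv hu0 hv0)).trans hyv.symm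

theorem finite_aperySet {S : AddSubmonoid ℕ} (hS : ((S : Set ℕ)ᶜ).Finite) (a : ℕ) :
    (aperySet S a).Finite := by
  refine ((Set.finite_Iio a).union (hS.image (· + a))).subset fun w hw => ?_
  by_cases h : w < a
  · exact Or.inl h
  · have hwa : w = w - a + a := by omega
    exact Or.inr ⟨w - a, fun hmem => hw.2 ⟨_, hmem, hwa⟩, hwa.symm⟩

/-- For a numerical semigroup `S` minimally generated by `m_1 < ⋯ < m_e`, the
catenary degree of `S` satisfies
`c(S) = max{c(n) : n ∈ {m_2, …, m_e} + (Ap(S, m_1) \ {0})}`. -/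
theorem catenary_degree_via_apery (e : ℕ) (he : 0 < e) (m : Fin e → ℕ)
    (S : AddSubmonoid ℕ) (hS : ((S : Set ℕ)ᶜ).Finite)
    (hgen : AddSubmonoid.closure (Set.range m) = S)
    (hmono : StrictMono m)
    (hmin : ∀ i, m i ∉ AddSubmonoid.closure (Set.range m \ {m i})) :
    sSup {c : ℕ | ∃ n ∈ S, c = catDeg m n} =
      sSup {c : ℕ | ∃ i : Fin e, i ≠ ⟨0, he⟩ ∧
        ∃ w ∈ aperySet S (m ⟨0, he⟩), w ≠ 0 ∧ c = catDeg m (m i + w)} := by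
  subst hgen
  set A : Set ℕ := {c : ℕ | ∃ i : Fin e, i ≠ ⟨0, he⟩ ∧
    ∃ w ∈ aperySet (AddSubmonoid.closure (Set.range m)) (m ⟨0, he⟩), w ≠ 0 ∧
      c = catDeg m (m i + w)}
  have hbdd : BddAbove A := by
    refine Set.Finite.bddAbove ((Set.Finite.image2 (fun i w => catDeg m (m i + w))
      (Set.finite_univ (α := Fin e)) (finite_aperySet hS (m ⟨0, he⟩))).subset ?_)
    rintro _ ⟨i, -, w, hw, -, rfl⟩
    exact ⟨i, trivial, w, hw, rfl⟩
  have hle : ∀ n, catDeg m n ≤ sSup A := fun n => Nat.sInf_le fun x hx y hy =>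
    chainJoined_of_forall_aperySet ⟨0, he⟩ hmono.injective hmin
      (fun i hi w hw hw0 => le_csSup hbdd ⟨i, hi, w, hw, hw0, rfl⟩) hx hy
  refine le_antisymm (csSup_le ⟨_, 0, zero_mem _, rfl⟩ ?_) (csSup_le_csSup' ?_ ?_)
  · rintro _ ⟨n, -, rfl⟩
    exact hle n
  · refine ⟨sSup A, ?_⟩
    rintro _ ⟨n, -, rfl⟩
    exact hle n
  · rintro _ ⟨i, -, w, hw, -, rfl⟩
    exact ⟨_, add_mem (AddSubmonoid.subset_closure ⟨i, rfl⟩) hw.1, rfl⟩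
end
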